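/- There exists exactly one triple (a, b, c) of three times continuously differentiable functions from [0,L] to ℝ satisfying the coupled system: a' + a''' + φ1·φ1' − c1·φ2 + q·b = 0 on [0,L] with a(0) = a(L) = 0 and a'(L) = 0; b' + b''' + φ1·φ2' + φ1'·φ2 + c1·φ1 − √3·c1·φ2 − 2q·a + 2q·c = 0 on [0,L] with b(0) = b(L) = 0 and b'(L) = 0; and c' + c''' + φ2·φ2' + √3·c1·φ1 − q·b = 0 on [0,L] with c(0) = c(L) = 0 and c'(L) = 0. -/

import Mathlib

noncomputable def L : ℝ := 2 * Real.pi * Real.sqrt (7 / 3)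

noncomputable def q : ℝ := 20 / (21 * Real.sqrt 21)

noncomputable def Θ : ℝ := (1 / Real.sqrt (14 * Real.pi)) * (3 / 7 : ℝ) ^ ((1 : ℝ) / 4)

noncomputable def φ1 (x : ℝ) : ℝ :=
  Θ * (Real.cos (5 * x / Real.sqrt 21) - 3 * Real.cos (x / Real.sqrt 21)
      + 2 * Real.cos (4 * x / Real.sqrt 21))

noncomputable def φ2 (x : ℝ) : ℝ :=
  Θ * (-Real.sin (5 * x / Real.sqrt 21) - 3 * Real.sin (x / Real.sqrt 21)
      + 2 * Real.sin (4 * x / Real.sqrt 21))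


noncomputable def c1 : ℝ :=
  (177147 / (392392 * Real.pi)) * Real.sqrt (1 / (2 * Real.pi)) * (3 / 7 : ℝ) ^ ((1 : ℝ) / 4)

/-- The coupled system \eqref{a21}--\eqref{a23} for (a, b, c), each C³ on [0,L]. -/
def SolvesSystem (a b c : ℝ → ℝ) : Prop :=
  ContDiffOn ℝ 3 a (Set.Icc 0 L) ∧ ContDiffOn ℝ 3 b (Set.Icc 0 L) ∧
  ContDiffOn ℝ 3 c (Set.Icc 0 L) ∧
  (∀ x ∈ Set.Icc (0 : ℝ) L,
    iteratedDerivWithin 1 a (Set.Icc 0 L) x + iteratedDerivWithin 3 a (Set.Icc 0 L) x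
      + φ1 x * deriv φ1 x - c1 * φ2 x + q * b x = 0) ∧
  a 0 = 0 ∧ a L = 0 ∧ iteratedDerivWithin 1 a (Set.Icc 0 L) L = 0 ∧
  (∀ x ∈ Set.Icc (0 : ℝ) L,
    iteratedDerivWithin 1 b (Set.Icc 0 L) x + iteratedDerivWithin 3 b (Set.Icc 0 L) x
      + φ1 x * deriv φ2 x + deriv φ1 x * φ2 x + c1 * φ1 x - Real.sqrt 3 * c1 * φ2 x
      - 2 * q * a x + 2 * q * c x = 0) ∧
  b 0 = 0 ∧ b L = 0 ∧ iteratedDerivWithin 1 b (Set.Icc 0 L) L = 0 ∧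
  (∀ x ∈ Set.Icc (0 : ℝ) L,
    iteratedDerivWithin 1 c (Set.Icc 0 L) x + iteratedDerivWithin 3 c (Set.Icc 0 L) x
      + φ2 x * deriv φ2 x + Real.sqrt 3 * c1 * φ1 x - q * b x = 0) ∧
  c 0 = 0 ∧ c L = 0 ∧ iteratedDerivWithin 1 c (Set.Icc 0 L) L = 0

open Set in
lemma const_aux {T : ℝ} {f : ℝ → ℂ}
    (hf : ∀ x ∈ Icc 0 T, HasDerivWithinAt f 0 (Icc 0 T) x) :
    ∀ x ∈ Icc 0 T, f x = f 0 := by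
  apply constant_of_has_deriv_right_zero
  · exact fun x hx => (hf x hx).continuousWithinAt
  · intro x hx
    refine (hf x ⟨hx.1, hx.2.le⟩).mono_of_mem_nhdsWithin ?_
    exact mem_nhdsWithin.2 ⟨Iio T, isOpen_Iio, hx.2, fun y hy => ⟨hx.1.trans hy.2, hy.1.le⟩⟩

lemma expHas (r : ℂ) (x : ℝ) :
    HasDerivAt (fun x : ℝ => Complex.exp (r * x)) (r * Complex.exp (r * x)) x := by
  have h : HasDerivAt (fun x : ℝ => r * (x : ℂ)) (r * 1) x :=
    (Complex.ofRealCLM.hasDerivAt (x := x)).const_mul r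
  have := h.cexp
  refine HasDerivAt.congr_deriv (this) (Eq.symm ?_)
  ring

open Set in
lemma factor_aux {T : ℝ} {μ r : ℂ} (hr : r ^ 3 + r = μ) {w w1 w2 : ℝ → ℂ}
    (hw : ∀ x ∈ Icc 0 T, HasDerivWithinAt w (w1 x) (Icc 0 T) x)
    (hw1 : ∀ x ∈ Icc 0 T, HasDerivWithinAt w1 (w2 x) (Icc 0 T) x)
    (hw2 : ∀ x ∈ Icc 0 T, HasDerivWithinAt w2 (μ * w x - w1 x) (Icc 0 T) x) :
    ∀ x ∈ Icc 0 T, w2 x + r * w1 x + (r ^ 2 + 1) * w x =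
      Complex.exp (r * x) * (w2 0 + r * w1 0 + (r ^ 2 + 1) * w 0) := by
  intro x hx
  have key := const_aux (T := T)
    (f := fun x => Complex.exp ((-r) * x) * (w2 x + r * w1 x + (r ^ 2 + 1) * w x)) (by
      intro x hx
      have := (expHas (-r) x).hasDerivWithinAt (s := Icc 0 T) |>.mul
        (((hw2 x hx).add ((hw1 x hx).const_mul r)).add ((hw x hx).const_mul (r ^ 2 + 1)))
      refine HasDerivWithinAt.congr_deriv (this) (Eq.symm ?_)
      try simp only [Pi.add_apply]
      rw [← hr]
      ring) x hx
  simp only [Complex.ofReal_zero, mul_zero, Complex.exp_zero, one_mul] at key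
  rw [← key, ← mul_assoc, ← Complex.exp_add]
  simp

open Set in
lemma uniq_aux {T : ℝ} (hT : 0 < T) {μ r1 r2 r3 : ℂ} (h1 : r1 ^ 3 + r1 = μ)
    (h2 : r2 ^ 3 + r2 = μ) (h3 : r3 ^ 3 + r3 = μ) (h12 : r1 ≠ r2) (h13 : r1 ≠ r3) (h23 : r2 ≠ r3)
    (hμ : μ + star μ = 0)
    (hexp : ¬ (Complex.exp (r1 * T) = Complex.exp (r2 * T) ∧
      Complex.exp (r1 * T) = Complex.exp (r3 * T)))
    {w w1 w2 : ℝ → ℂ}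
    (hw : ∀ x ∈ Icc 0 T, HasDerivWithinAt w (w1 x) (Icc 0 T) x)
    (hw1 : ∀ x ∈ Icc 0 T, HasDerivWithinAt w1 (w2 x) (Icc 0 T) x)
    (hw2 : ∀ x ∈ Icc 0 T, HasDerivWithinAt w2 (μ * w x - w1 x) (Icc 0 T) x)
    (b0 : w 0 = 0) (bT : w T = 0) (bT1 : w1 T = 0) :
    (∀ x ∈ Icc 0 T, w x = 0) ∧ w1 0 = 0 ∧ w2 0 = 0 := by
  have m0 : (0 : ℝ) ∈ Icc 0 T := ⟨le_rfl, hT.le⟩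
  have mT : T ∈ Icc 0 T := ⟨hT.le, le_rfl⟩
  have E := const_aux (T := T)
    (f := fun x => w2 x * star (w x) + w x * star (w2 x) - w1 x * star (w1 x) + w x * star (w x))
    (by
      intro x hx
      have d0 := hw x hx
      have d1 := hw1 x hx
      have d2 := hw2 x hx
      have := (((d2.mul d0.star).add (d0.mul d2.star)).sub (d1.mul d1.star)).add (d0.mul d0.star)
      refine HasDerivWithinAt.congr_deriv (this) (Eq.symm ?_)
      try simp only [star_sub, star_mul']
      have : star μ = -μ := by linear_combination hμ
      rw [this]
      ring) T mT
  simp only [b0, bT, bT1, star_zero, mul_zero, zero_mul, add_zero, sub_zero, zero_sub]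
    at E
  have w10 : w1 0 = 0 := by
    have : w1 0 * star (w1 0) = 0 := by linear_combination E
    rcases mul_eq_zero.1 this with h | h
    · exact h
    · exact star_eq_zero.1 h
  have f1 := factor_aux h1 hw hw1 hw2
  have f2 := factor_aux h2 hw hw1 hw2
  have f3 := factor_aux h3 hw hw1 hw2
  simp only [b0, w10, mul_zero, add_zero] at f1 f2 f3
  have w20 : w2 0 = 0 := by
    by_contra hne
    apply hexp
    have g1 := f1 T mT
    have g2 := f2 T mT
    have g3 := f3 T mT
    simp only [bT, bT1, mul_zero, add_zero] at g1 g2 g3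
    exact ⟨mul_right_cancel₀ hne (g1.symm.trans g2), mul_right_cancel₀ hne (g1.symm.trans g3)⟩
  refine ⟨?_, w10, w20⟩
  intro x hx
  have g1 := f1 x hx
  have g2 := f2 x hx
  have g3 := f3 x hx
  rw [w20, mul_zero] at g1 g2 g3
  have k12 : w1 x + (r1 + r2) * w x = 0 := by
    apply mul_left_cancel₀ (sub_ne_zero.2 h12)
    linear_combination g1 - g2
  have k13 : w1 x + (r1 + r3) * w x = 0 := by
    apply mul_left_cancel₀ (sub_ne_zero.2 h13)
    linear_combination g1 - g3
  apply mul_left_cancel₀ (sub_ne_zero.2 h23)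
  linear_combination k12 - k13

lemma first_order (r : ℂ) {F : ℝ → ℂ} (hF : Continuous F) :
    ∃ v : ℝ → ℂ, ∀ x, HasDerivAt v (r * v x + F x) x := by
  have hc : Continuous (fun t : ℝ => Complex.exp ((-r) * t) * F t) := by fun_prop
  refine ⟨fun x => Complex.exp (r * x) * ∫ t in (0 : ℝ)..x, Complex.exp ((-r) * t) * F t, ?_⟩
  intro x
  have := (expHas r x).mul (hc.integral_hasStrictDerivAt 0 x).hasDerivAt
  refine HasDerivAt.congr_deriv (this) (Eq.symm ?_)
  rw [← mul_assoc (Complex.exp (r * x)) (Complex.exp (-r * x)), ← Complex.exp_add]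
  simp
  ring

lemma particular (r1 r2 r3 μ : ℂ) (e1 : r1 + r2 + r3 = 0) (e2 : r1 * r2 + r1 * r3 + r2 * r3 = 1)
    (e3 : r1 * r2 * r3 = μ) {F : ℝ → ℂ} (hF : Continuous F) :
    ∃ w w1 w2 : ℝ → ℂ, (∀ x, HasDerivAt w (w1 x) x) ∧ (∀ x, HasDerivAt w1 (w2 x) x) ∧
      (∀ x, HasDerivAt w2 (μ * w x - w1 x + F x) x) := by
  obtain ⟨v1, h1⟩ := first_order r1 hF
  obtain ⟨v2, h2⟩ := first_order r2 (F := v1)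
    (continuous_iff_continuousAt.2 fun x => (h1 x).continuousAt)
  obtain ⟨v3, h3⟩ := first_order r3 (F := v2)
    (continuous_iff_continuousAt.2 fun x => (h2 x).continuousAt)
  refine ⟨v3, fun x => r3 * v3 x + v2 x, fun x => r3 * (r3 * v3 x + v2 x) + (r2 * v2 x + v1 x),
    h3, ?_, ?_⟩
  · intro x
    exact ((h3 x).const_mul r3).add (h2 x)
  · intro x
    have := ((((h3 x).const_mul r3).add (h2 x)).const_mul r3).add
      (((h2 x).const_mul r2).add (h1 x))
    refine HasDerivAt.congr_deriv (this) (Eq.symm ?_)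
    have : r1 = - r2 - r3 := by linear_combination e1
    subst this
    rw [← e3]
    linear_combination (r3 * v3 x + v2 x) * e2

lemma bvp_exists {T : ℝ} (hT : 0 < T) {μ r1 r2 r3 : ℂ} (e1 : r1 + r2 + r3 = 0)
    (e2 : r1 * r2 + r1 * r3 + r2 * r3 = 1)
    (e3 : r1 * r2 * r3 = μ) (h12 : r1 ≠ r2) (h13 : r1 ≠ r3) (h23 : r2 ≠ r3)
    (hμ : μ + star μ = 0)
    (hexp : ¬ (Complex.exp (r1 * T) = Complex.exp (r2 * T) ∧
      Complex.exp (r1 * T) = Complex.exp (r3 * T)))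
    {F : ℝ → ℂ} (hF : Continuous F) :
    ∃ w w1 w2 : ℝ → ℂ, (∀ x, HasDerivAt w (w1 x) x) ∧ (∀ x, HasDerivAt w1 (w2 x) x) ∧
      (∀ x, HasDerivAt w2 (μ * w x - w1 x + F x) x) ∧ w 0 = 0 ∧ w T = 0 ∧ w1 T = 0 := by
  have h1 : r1 ^ 3 + r1 = μ := by linear_combination e3 + r1 ^ 2 * e1 - r1 * e2
  have h2 : r2 ^ 3 + r2 = μ := by linear_combination e3 + r2 ^ 2 * e1 - r2 * e2
  have h3 : r3 ^ 3 + r3 = μ := by linear_combination e3 + r3 ^ 2 * e1 - r3 * e2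
  obtain ⟨p, p1, p2, hp, hp1, hp2⟩ := particular r1 r2 r3 μ e1 e2 e3 hF
  let H : ℂ × ℂ × ℂ → ℕ → ℝ → ℂ := fun α n x =>
    α.1 * (r1 ^ n * Complex.exp (r1 * x)) + α.2.1 * (r2 ^ n * Complex.exp (r2 * x))
      + α.2.2 * (r3 ^ n * Complex.exp (r3 * x))
  have hH : ∀ α n x, HasDerivAt (H α n) (H α (n + 1) x) x := by
    intro α n x
    have := ((((expHas r1 x).const_mul (r1 ^ n)).const_mul α.1).add
      (((expHas r2 x).const_mul (r2 ^ n)).const_mul α.2.1)).add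
      (((expHas r3 x).const_mul (r3 ^ n)).const_mul α.2.2)
    refine HasDerivAt.congr_deriv (this) (Eq.symm ?_)
    simp only [H]
    ring
  have hH3 : ∀ α x, H α 3 x = μ * H α 0 x - H α 1 x := by
    intro α x
    simp only [H]
    linear_combination (α.1 * Complex.exp (r1 * x)) * h1 + (α.2.1 * Complex.exp (r2 * x)) * h2
      + (α.2.2 * Complex.exp (r3 * x)) * h3
  let M : (ℂ × ℂ × ℂ) →ₗ[ℂ] (ℂ × ℂ × ℂ) :=
    { toFun := fun α => (H α 0 0, H α 0 T, H α 1 T)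
      map_add' := by
        intro α β
        simp only [H, Prod.mk_add_mk, Prod.fst_add, Prod.snd_add]
        refine Prod.ext ?_ (Prod.ext ?_ ?_) <;> simp only <;> ring
      map_smul' := by
        intro s α
        simp only [H, Prod.smul_mk, Prod.smul_fst, Prod.smul_snd, smul_eq_mul, RingHom.id_apply]
        refine Prod.ext ?_ (Prod.ext ?_ ?_) <;> simp only <;> ring }
  have hinj : Function.Injective M := by
    rw [← LinearMap.ker_eq_bot, LinearMap.ker_eq_bot']
    intro α hα
    have hα' : (H α 0 0, H α 0 T, H α 1 T) = ((0, 0, 0) : ℂ × ℂ × ℂ) := hα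
    simp only [Prod.mk.injEq] at hα'
    obtain ⟨a0, aT, aT1⟩ := hα'
    obtain ⟨-, d1, d2⟩ := uniq_aux hT h1 h2 h3 h12 h13 h23 hμ hexp (w := H α 0) (w1 := H α 1)
      (w2 := H α 2) (fun x _ => (hH α 0 x).hasDerivWithinAt)
      (fun x _ => (hH α 1 x).hasDerivWithinAt)
      (fun x _ => by rw [← hH3]; exact (hH α 2 x).hasDerivWithinAt) a0 aT aT1
    simp only [H, Complex.ofReal_zero, mul_zero, Complex.exp_zero, mul_one, pow_zero, pow_one]
      at a0 d1 d2
    have z1 : α.1 = 0 := by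
      apply mul_left_cancel₀ (mul_ne_zero (sub_ne_zero.2 h12) (sub_ne_zero.2 h13))
      linear_combination d2 - (r2 + r3) * d1 + r2 * r3 * a0
    have z2 : α.2.1 = 0 := by
      apply mul_left_cancel₀ (mul_ne_zero (sub_ne_zero.2 h12.symm) (sub_ne_zero.2 h23))
      linear_combination d2 - (r1 + r3) * d1 + r1 * r3 * a0
    have z3 : α.2.2 = 0 := by
      linear_combination a0 - z1 - z2
    exact Prod.ext z1 (Prod.ext z2 z3)
  obtain ⟨α, hα⟩ := (LinearMap.injective_iff_surjective.1 hinj) (p 0, p T, p1 T)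
  have hα' : (H α 0 0, H α 0 T, H α 1 T) = (p 0, p T, p1 T) := hα
  simp only [Prod.mk.injEq] at hα'
  obtain ⟨a0, aT, aT1⟩ := hα'
  refine ⟨fun x => p x - H α 0 x, fun x => p1 x - H α 1 x, fun x => p2 x - H α 2 x,
    fun x => (hp x).sub (hH α 0 x), fun x => (hp1 x).sub (hH α 1 x), fun x => ?_, ?_, ?_, ?_⟩
  · refine HasDerivAt.congr_deriv ((hp2 x).sub (hH α 2 x)) (Eq.symm ?_)
    rw [hH3]
    ring
  · simp [a0]
  · simp [aT]
  · simp [aT1]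

open Set in
/-- chain of derivatives gives `C³` and identifies the iterated derivatives -/
lemma chain_to {T : ℝ} (hT : 0 < T) {f f1 f2 f3 : ℝ → ℝ} (h : ∀ x, HasDerivAt f (f1 x) x)
    (h1 : ∀ x, HasDerivAt f1 (f2 x) x) (h2 : ∀ x, HasDerivAt f2 (f3 x) x) (h3 : Continuous f3) :
    ContDiffOn ℝ 3 f (Icc 0 T) ∧ (∀ x ∈ Icc 0 T, iteratedDerivWithin 1 f (Icc 0 T) x = f1 x) ∧
      (∀ x ∈ Icc 0 T, iteratedDerivWithin 3 f (Icc 0 T) x = f3 x) := by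
  have u := uniqueDiffOn_Icc hT
  have e0 : deriv f = f1 := funext fun x => (h x).deriv
  have e1 : deriv f1 = f2 := funext fun x => (h1 x).deriv
  have e2 : deriv f2 = f3 := funext fun x => (h2 x).deriv
  have c2 : ContDiff ℝ 1 f2 :=
    contDiff_one_iff_deriv.2 ⟨fun x => (h2 x).differentiableAt, e2 ▸ h3⟩
  have c1 : ContDiff ℝ (1 + 1) f1 :=
    contDiff_succ_iff_deriv.2 ⟨fun x => (h1 x).differentiableAt, by simp, e1 ▸ c2⟩
  have c0 : ContDiff ℝ (1 + 1 + 1) f :=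
    contDiff_succ_iff_deriv.2 ⟨fun x => (h x).differentiableAt, by simp, e0 ▸ c1⟩
  have c0' : ContDiff ℝ 3 f := by
    have : (1 + 1 + 1 : WithTop ℕ∞) = 3 := by norm_num
    rwa [this] at c0
  refine ⟨c0'.contDiffOn, fun x hx => ?_, fun x hx => ?_⟩
  · rw [iteratedDerivWithin_eq_iteratedDeriv u (c0'.contDiffAt.of_le (by norm_num)) hx,
      iteratedDeriv_one, e0]
  · rw [iteratedDerivWithin_eq_iteratedDeriv u (c0'.contDiffAt.of_le (by norm_num)) hx,
      iteratedDeriv_succ', iteratedDeriv_succ', iteratedDeriv_one, e0, e1, e2]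

open Set in
lemma chain_from {T : ℝ} (hT : 0 < T) {f : ℝ → ℝ} (h : ContDiffOn ℝ 3 f (Icc 0 T)) :
    ∀ x ∈ Icc 0 T,
      HasDerivWithinAt f (iteratedDerivWithin 1 f (Icc 0 T) x) (Icc 0 T) x ∧
      HasDerivWithinAt (iteratedDerivWithin 1 f (Icc 0 T)) (iteratedDerivWithin 2 f (Icc 0 T) x)
        (Icc 0 T) x ∧
      HasDerivWithinAt (iteratedDerivWithin 2 f (Icc 0 T)) (iteratedDerivWithin 3 f (Icc 0 T) x)
        (Icc 0 T) x := by
  intro x hx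
  have u := uniqueDiffOn_Icc hT
  have key : ∀ n : ℕ, n < 3 → HasDerivWithinAt (iteratedDerivWithin n f (Icc 0 T))
      (iteratedDerivWithin (n + 1) f (Icc 0 T) x) (Icc 0 T) x := by
    intro n hn
    rw [iteratedDerivWithin_succ]
    apply DifferentiableWithinAt.hasDerivWithinAt
    exact h.differentiableOn_iteratedDerivWithin (by exact_mod_cast hn) u x hx
  refine ⟨?_, key 1 (by norm_num), key 2 (by norm_num)⟩
  have := key 0 (by norm_num)
  rwa [iteratedDerivWithin_zero] at this

lemma L_pos : 0 < L := by unfold L; positivity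

lemma expI_ne : Complex.exp (Complex.I * L) ≠ 1 := by
  intro h
  obtain ⟨n, hn⟩ := Complex.exp_eq_one_iff.1 h
  have h1 : (L : ℂ) = ((n * (2 * Real.pi) : ℝ) : ℂ) := by
    apply mul_left_cancel₀ Complex.I_ne_zero
    rw [hn]; push_cast; ring
  have h2 : L = n * (2 * Real.pi) := by exact_mod_cast h1
  unfold L at h2
  have h3 : Real.sqrt (7 / 3) = n := by
    apply mul_left_cancel₀ (show (2 * Real.pi) ≠ 0 by positivity)
    linarith
  have h4 : (7 / 3 : ℝ) = (n : ℝ) ^ 2 := by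
    rw [← h3, Real.sq_sqrt (by norm_num)]
  have h5 : (7 : ℤ) = 3 * n ^ 2 := by
    have : (7 : ℝ) = 3 * (n : ℝ) ^ 2 := by linarith
    exact_mod_cast this
  omega

/-- roots for the coupled equation -/
lemma roots_q : ∃ r1 r2 r3 : ℂ, r1 + r2 + r3 = 0 ∧ r1 * r2 + r1 * r3 + r2 * r3 = 1 ∧
    r1 * r2 * r3 = -(2 * q * Complex.I) ∧ r1 ≠ r2 ∧ r1 ≠ r3 ∧ r2 ≠ r3 ∧
    ¬ (Complex.exp (r1 * L) = Complex.exp (r2 * L) ∧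
      Complex.exp (r1 * L) = Complex.exp (r3 * L)) := by
  have hs : (40 : ℝ) ∈ (fun s : ℝ => s ^ 3 - 21 * s) '' Set.Icc (5.3 : ℝ) 6 := by
    apply intermediate_value_Icc (by norm_num) (by fun_prop)
    constructor <;> norm_num
  obtain ⟨s, ⟨hs1, -⟩, hs2⟩ := hs
  simp only at hs2
  have h21 : Real.sqrt 21 ^ 2 = 21 := Real.sq_sqrt (by norm_num)
  have h21p : 0 < Real.sqrt 21 := by positivity
  obtain ⟨l, hl⟩ : ∃ l, l = s / Real.sqrt 21 := ⟨_, rfl⟩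
  have hsl : s = l * Real.sqrt 21 := by rw [hl]; field_simp
  have hl3 : l ^ 3 - l = 2 * q := by
    unfold q
    rw [hl]
    field_simp
    rw [h21]
    linear_combination 21 * hs2
  have hl2 : 0 < 3 * l ^ 2 - 4 := by
    have : s ^ 2 = l ^ 2 * 21 := by rw [hsl, mul_pow, h21]
    nlinarith
  obtain ⟨d, hd⟩ : ∃ d, d = Real.sqrt (3 * l ^ 2 - 4) := ⟨_, rfl⟩
  have hd0 : 0 < d := by rw [hd]; exact Real.sqrt_pos.2 hl2
  have hd2 : d ^ 2 = 3 * l ^ 2 - 4 := by rw [hd]; exact Real.sq_sqrt hl2.le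
  have hd2' : (d : ℂ) ^ 2 = 3 * (l : ℂ) ^ 2 - 4 := by exact_mod_cast hd2
  have hl3' : (l : ℂ) ^ 3 - l = 2 * (q : ℂ) := by exact_mod_cast hl3
  have hI := Complex.I_sq
  have re1 : (Complex.I * l : ℂ).re = 0 := by simp
  have re2 : ((-(Complex.I * l) + d) / 2 : ℂ).re = d / 2 := by
    simp
  have re3 : ((-(Complex.I * l) - d) / 2 : ℂ).re = - d / 2 := by
    simp
  refine ⟨Complex.I * l, (-(Complex.I * l) + d) / 2, (-(Complex.I * l) - d) / 2, by ring, ?_, ?_,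
    ?_, ?_, ?_, ?_⟩
  · linear_combination (-3 / 4 * (l : ℂ) ^ 2) * hI - hd2' / 4
  · linear_combination (Complex.I * (l : ℂ) ^ 3 / 4) * hI - Complex.I * l * hd2' / 4
      - Complex.I * hl3'
  · intro h; have := congrArg Complex.re h; rw [re1, re2] at this; linarith
  · intro h; have := congrArg Complex.re h; rw [re1, re3] at this; linarith
  · intro h; have := congrArg Complex.re h; rw [re2, re3] at this; linarith
  · rintro ⟨h, -⟩
    have := congrArg norm h
    rw [Complex.norm_exp, Complex.norm_exp, Complex.re_mul_ofReal (Complex.I * l), Complex.re_mul_ofReal ((-(Complex.I * l) + d) / 2), re1, re2,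
      Real.exp_eq_exp] at this
    have := mul_pos hd0 L_pos
    linarith

lemma φ1_cd : ContDiff ℝ 1 φ1 := by unfold φ1; fun_prop
lemma φ2_cd : ContDiff ℝ 1 φ2 := by unfold φ2; fun_prop

open Set in
lemma uniq_real {f f1 f2 g g1 g2 k k1 k2 : ℝ → ℝ}
    (hf : ∀ x ∈ Icc 0 L, HasDerivWithinAt f (f1 x) (Icc 0 L) x)
    (hf1 : ∀ x ∈ Icc 0 L, HasDerivWithinAt f1 (f2 x) (Icc 0 L) x)
    (hf2 : ∀ x ∈ Icc 0 L, HasDerivWithinAt f2 (- f1 x - q * g x) (Icc 0 L) x)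
    (hg : ∀ x ∈ Icc 0 L, HasDerivWithinAt g (g1 x) (Icc 0 L) x)
    (hg1 : ∀ x ∈ Icc 0 L, HasDerivWithinAt g1 (g2 x) (Icc 0 L) x)
    (hg2 : ∀ x ∈ Icc 0 L, HasDerivWithinAt g2 (- g1 x + 2 * q * f x - 2 * q * k x) (Icc 0 L) x)
    (hk : ∀ x ∈ Icc 0 L, HasDerivWithinAt k (k1 x) (Icc 0 L) x)
    (hk1 : ∀ x ∈ Icc 0 L, HasDerivWithinAt k1 (k2 x) (Icc 0 L) x)
    (hk2 : ∀ x ∈ Icc 0 L, HasDerivWithinAt k2 (- k1 x + q * g x) (Icc 0 L) x)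
    (f0 : f 0 = 0) (fL : f L = 0) (f1L : f1 L = 0)
    (g0 : g 0 = 0) (gL : g L = 0) (g1L : g1 L = 0)
    (k0 : k 0 = 0) (kL : k L = 0) (k1L : k1 L = 0) :
    ∀ x ∈ Icc 0 L, f x = 0 ∧ g x = 0 ∧ k x = 0 := by
  obtain ⟨r1, r2, r3, e1, e2, e3, h12, h13, h23, hexp⟩ := roots_q
  have U := (uniq_aux (T := L) L_pos (μ := 0) (r1 := 0) (r2 := Complex.I) (r3 := -Complex.I)
    (by simp) (by simp [pow_succ]) (by simp [pow_succ]) Complex.I_ne_zero.symm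
    (neg_ne_zero.2 Complex.I_ne_zero).symm (by
      intro h
      have := congrArg Complex.im h
      norm_num at this) (by simp)
    (fun h => expI_ne (by simpa using h.1.symm))
    (w := fun x => ((f x + k x : ℝ) : ℂ)) (w1 := fun x => ((f1 x + k1 x : ℝ) : ℂ))
    (w2 := fun x => ((f2 x + k2 x : ℝ) : ℂ))
    (fun x hx => ((hf x hx).add (hk x hx)).ofReal_comp)
    (fun x hx => ((hf1 x hx).add (hk1 x hx)).ofReal_comp)
    (fun x hx => by
      refine HasDerivWithinAt.congr_deriv (((hf2 x hx).add (hk2 x hx)).ofReal_comp) (Eq.symm ?_)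
      push_cast; ring)
    (by simp [f0, k0]) (by simp [fL, kL]) (by simp [f1L, k1L])).1
  have W := (uniq_aux (T := L) L_pos (μ := -(2 * q * Complex.I)) (r1 := r1) (r2 := r2) (r3 := r3)
    (by linear_combination e3 + r1 ^ 2 * e1 - r1 * e2)
    (by linear_combination e3 + r2 ^ 2 * e1 - r2 * e2)
    (by linear_combination e3 + r3 ^ 2 * e1 - r3 * e2) h12 h13 h23
    (by simp) hexp
    (w := fun x => ((f x - k x : ℝ) : ℂ) - Complex.I * (g x : ℂ))
    (w1 := fun x => ((f1 x - k1 x : ℝ) : ℂ) - Complex.I * (g1 x : ℂ))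
    (w2 := fun x => ((f2 x - k2 x : ℝ) : ℂ) - Complex.I * (g2 x : ℂ))
    (fun x hx => ((hf x hx).sub (hk x hx)).ofReal_comp.sub ((hg x hx).ofReal_comp.const_mul _))
    (fun x hx => ((hf1 x hx).sub (hk1 x hx)).ofReal_comp.sub ((hg1 x hx).ofReal_comp.const_mul _))
    (fun x hx => by
      refine HasDerivWithinAt.congr_deriv (((hf2 x hx).sub (hk2 x hx)).ofReal_comp.sub
        ((hg2 x hx).ofReal_comp.const_mul Complex.I)) (Eq.symm ?_)
      push_cast
      linear_combination (2 * q * g x : ℂ) * Complex.I_sq)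
    (by simp [f0, k0, g0]) (by simp [fL, kL, gL]) (by simp [f1L, k1L, g1L])).1
  intro x hx
  have u := U x hx
  have w := W x hx
  have u' : f x + k x = 0 := by exact_mod_cast u
  have wr := congrArg Complex.re w
  have wi := congrArg Complex.im w
  simp at wr wi
  refine ⟨by linarith, wi, by linarith⟩

theorem stmt_13 :
    ∃ a b c : ℝ → ℝ, SolvesSystem a b c ∧
      ∀ a' b' c' : ℝ → ℝ, SolvesSystem a' b' c' →
        ∀ x ∈ Set.Icc (0 : ℝ) L, a' x = a x ∧ b' x = b x ∧ c' x = c x := by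
  have c11 : Continuous φ1 := φ1_cd.continuous
  have c22 : Continuous φ2 := φ2_cd.continuous
  have d11 : Continuous (deriv φ1) := φ1_cd.continuous_deriv le_rfl
  have d22 : Continuous (deriv φ2) := φ2_cd.continuous_deriv le_rfl
  obtain ⟨A, hA⟩ : ∃ A : ℝ → ℝ, A = fun x => φ1 x * deriv φ1 x - c1 * φ2 x := ⟨_, rfl⟩
  obtain ⟨B, hB⟩ : ∃ B : ℝ → ℝ, B = fun x => φ1 x * deriv φ2 x + deriv φ1 x * φ2 x + c1 * φ1 x
    - Real.sqrt 3 * c1 * φ2 x := ⟨_, rfl⟩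
  obtain ⟨C, hC⟩ : ∃ C : ℝ → ℝ, C = fun x => φ2 x * deriv φ2 x + Real.sqrt 3 * c1 * φ1 x :=
    ⟨_, rfl⟩
  have cA : Continuous A := by rw [hA]; fun_prop
  have cB : Continuous B := by rw [hB]; fun_prop
  have cC : Continuous C := by rw [hC]; fun_prop
  obtain ⟨r1, r2, r3, e1, e2, e3, h12, h13, h23, hexp⟩ := roots_q
  obtain ⟨u, u1, u2, hu, hu1, hu2, u0, uL, u1L⟩ := bvp_exists (T := L) L_pos (μ := 0) (r1 := 0)
    (r2 := Complex.I) (r3 := -Complex.I) (by simp) (by simp) (by simp)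
    Complex.I_ne_zero.symm (neg_ne_zero.2 Complex.I_ne_zero).symm (by
      intro h
      have := congrArg Complex.im h
      norm_num at this) (by simp)
    (fun h => expI_ne (by simpa using h.1.symm))
    (F := fun x => ((-(A x + C x) : ℝ) : ℂ)) (by fun_prop)
  obtain ⟨w, w1, w2, hw, hw1, hw2, w0, wL, w1L⟩ := bvp_exists (T := L) L_pos e1 e2 e3 h12 h13 h23
    (by simp) hexp
    (F := fun x => ((-(A x - C x) : ℝ) : ℂ) + Complex.I * (B x : ℂ)) (by fun_prop)
  have reD : ∀ {f : ℝ → ℂ} {f' : ℂ} {x : ℝ}, HasDerivAt f f' x →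
      HasDerivAt (fun x => (f x).re) f'.re x := fun h =>
    (Complex.reCLM.hasFDerivAt.comp_hasDerivAt _ h)
  have imD : ∀ {f : ℝ → ℂ} {f' : ℂ} {x : ℝ}, HasDerivAt f f' x →
      HasDerivAt (fun x => (f x).im) f'.im x := fun h =>
    (Complex.imCLM.hasFDerivAt.comp_hasDerivAt _ h)
  have cw : Continuous w := continuous_iff_continuousAt.2 fun x => (hw x).continuousAt
  have cw1 : Continuous w1 := continuous_iff_continuousAt.2 fun x => (hw1 x).continuousAt
  have cu : Continuous u := continuous_iff_continuousAt.2 fun x => (hu x).continuousAt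
  have cu1 : Continuous u1 := continuous_iff_continuousAt.2 fun x => (hu1 x).continuousAt
  obtain ⟨Sa, Sa1, Sa3⟩ := chain_to L_pos (f := fun x => ((u x).re + (w x).re) / 2)
    (f1 := fun x => ((u1 x).re + (w1 x).re) / 2) (f2 := fun x => ((u2 x).re + (w2 x).re) / 2)
    (f3 := fun x => -(((u1 x).re + (w1 x).re) / 2) - q * (-(w x).im) - A x)
    (fun x => ((reD (hu x)).add (reD (hw x))).div_const 2)
    (fun x => ((reD (hu1 x)).add (reD (hw1 x))).div_const 2)
    (fun x => by
      refine HasDerivAt.congr_deriv (((reD (hu2 x)).add (reD (hw2 x))).div_const 2) (Eq.symm ?_)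
      simp
      ring) (by fun_prop)
  obtain ⟨Sc, Sc1, Sc3⟩ := chain_to L_pos (f := fun x => ((u x).re - (w x).re) / 2)
    (f1 := fun x => ((u1 x).re - (w1 x).re) / 2) (f2 := fun x => ((u2 x).re - (w2 x).re) / 2)
    (f3 := fun x => -(((u1 x).re - (w1 x).re) / 2) + q * (-(w x).im) - C x)
    (fun x => ((reD (hu x)).sub (reD (hw x))).div_const 2)
    (fun x => ((reD (hu1 x)).sub (reD (hw1 x))).div_const 2)
    (fun x => by
      refine HasDerivAt.congr_deriv (((reD (hu2 x)).sub (reD (hw2 x))).div_const 2) (Eq.symm ?_)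
      simp
      ring) (by fun_prop)
  obtain ⟨Sb, Sb1, Sb3⟩ := chain_to L_pos (f := fun x => -(w x).im)
    (f1 := fun x => -(w1 x).im) (f2 := fun x => -(w2 x).im)
    (f3 := fun x => (w1 x).im + 2 * q * (w x).re - B x)
    (fun x => (imD (hw x)).neg)
    (fun x => (imD (hw1 x)).neg)
    (fun x => by
      refine HasDerivAt.congr_deriv ((imD (hw2 x)).neg) (Eq.symm ?_)
      simp
      ring) (by fun_prop)
  have mL : L ∈ Set.Icc (0 : ℝ) L := ⟨L_pos.le, le_rfl⟩
  have sol : SolvesSystem (fun x => ((u x).re + (w x).re) / 2) (fun x => -(w x).im)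
      (fun x => ((u x).re - (w x).re) / 2) := by
    refine ⟨Sa, Sb, Sc, ?_, by simp [u0, w0], by simp [uL, wL], ?_, ?_, by simp [w0], by simp [wL],
      ?_, ?_, by simp [u0, w0], by simp [uL, wL], ?_⟩
    · intro x hx
      rw [Sa1 x hx, Sa3 x hx, hA]
      ring
    · rw [Sa1 L mL]; simp [u1L, w1L]
    · intro x hx
      rw [Sb1 x hx, Sb3 x hx, hB]
      ring
    · rw [Sb1 L mL]; simp [w1L]
    · intro x hx
      rw [Sc1 x hx, Sc3 x hx, hC]
      ring
    · rw [Sc1 L mL]; simp [u1L, w1L]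
  suffices key : ∀ a b c : ℝ → ℝ, SolvesSystem a b c → ∀ a' b' c' : ℝ → ℝ, SolvesSystem a' b' c' →
      ∀ x ∈ Set.Icc (0 : ℝ) L, a' x = a x ∧ b' x = b x ∧ c' x = c x from
    ⟨_, _, _, sol, key _ _ _ sol⟩
  clear sol
  intro a b c sol
  intro a' b' c' sol' x hx
  obtain ⟨sa, sb, sc, ea, a0, aL, aL1, eb, b0, bL, bL1, ec, c0, cL, cL1⟩ := sol
  obtain ⟨sa', sb', sc', ea', a0', aL', aL1', eb', b0', bL', bL1', ec', c0', cL', cL1'⟩ := sol'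
  have ta := chain_from L_pos sa
  have tb := chain_from L_pos sb
  have tc := chain_from L_pos sc
  have ta' := chain_from L_pos sa'
  have tb' := chain_from L_pos sb'
  have tc' := chain_from L_pos sc'
  have := uniq_real (f := fun x => a' x - a x) (g := fun x => b' x - b x)
    (k := fun x => c' x - c x)
    (fun x hx => (ta' x hx).1.sub (ta x hx).1)
    (fun x hx => (ta' x hx).2.1.sub (ta x hx).2.1)
    (fun x hx => by
      refine HasDerivWithinAt.congr_deriv ((ta' x hx).2.2.sub (ta x hx).2.2) (Eq.symm ?_)
      linear_combination ea x hx - ea' x hx)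
    (fun x hx => (tb' x hx).1.sub (tb x hx).1)
    (fun x hx => (tb' x hx).2.1.sub (tb x hx).2.1)
    (fun x hx => by
      refine HasDerivWithinAt.congr_deriv ((tb' x hx).2.2.sub (tb x hx).2.2) (Eq.symm ?_)
      linear_combination eb x hx - eb' x hx)
    (fun x hx => (tc' x hx).1.sub (tc x hx).1)
    (fun x hx => (tc' x hx).2.1.sub (tc x hx).2.1)
    (fun x hx => by
      refine HasDerivWithinAt.congr_deriv ((tc' x hx).2.2.sub (tc x hx).2.2) (Eq.symm ?_)
      linear_combination ec x hx - ec' x hx)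
    (by simp [a0, a0']) (by simp [aL, aL']) (by simp [aL1, aL1'])
    (by simp [b0, b0']) (by simp [bL, bL']) (by simp [bL1, bL1'])
    (by simp [c0, c0']) (by simp [cL, cL']) (by simp [cL1, cL1']) x hx
  simp only [sub_eq_zero] at this
  exact this
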